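/- Let A and B be countable right-orderable groups, G = A ∗ B, and let w = a₁b₁⋯aₙbₙ ∈ G be a cyclically reduced word of length 2n with n ≥ 1 which is not a proper power (there are no v ∈ G and integer j ≥ 2 with w = vʲ). Let (w₁, w₂) be a prefix pair for w, i.e., w₁ and w₁w₂ are both nonempty prefixes of w. Then there exist a right action σ of G on ℝ by orientation-preserving homeomorphisms and a point x ∈ ℝ such that x·σ(w) = x and x·σ(w₁w₂) ≠ x·σ(w₁). -/

import Mathlib

/-- A group is right-orderable if there is a strict total order on it invariant
under right multiplication. -/
def IsRightOrderable (H : Type*) [Group H] : Prop :=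
  ∃ lt : H → H → Prop, IsStrictTotalOrder H lt ∧ ∀ f g h : H, lt f g → lt (f * h) (g * h)

/-- A right action of `G` on `ℝ` by orientation-preserving homeomorphisms, i.e. a map
to order-preserving bijections of `ℝ` satisfying `x·σ(gh) = (x·σ(g))·σ(h)`. -/
def IsRightAction {G : Type*} [Group G] (σ : G → (ℝ ≃o ℝ)) : Prop :=
  ∀ g h : G, σ (g * h) = (σ g).trans (σ h)

/-- The list of letters `a₁, b₁, …, aₙ, bₙ` of the word `w = a₁b₁⋯aₙbₙ` in `A ∗ B`. -/
def wordLetters {A B : Type*} [Group A] [Group B] {n : ℕ}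
    (a : Fin n → A) (b : Fin n → B) : List (Monoid.Coprod A B) :=
  (List.finRange n).flatMap fun i => [Monoid.Coprod.inl (a i), Monoid.Coprod.inr (b i)]

/-- The extension of a map `ℚ → ℚ` to `ℝ` by suprema. -/
noncomputable def ratExtend (φ : ℚ → ℚ) (x : ℝ) : ℝ :=
  sSup ((fun q : ℚ => (φ q : ℝ)) '' {q : ℚ | (q : ℝ) ≤ x})

theorem ratExtend_ratCast {φ : ℚ → ℚ} (hφ : Monotone φ) (q : ℚ) :
    ratExtend φ q = φ q := by
  refine IsGreatest.csSup_eq ⟨⟨q, le_refl (q : ℝ), rfl⟩, ?_⟩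
  rintro _ ⟨r, hr, rfl⟩
  exact Rat.cast_le.2 (hφ (Rat.cast_le.1 (show (r : ℝ) ≤ q from hr)))

theorem ratExtend_monotone {φ : ℚ → ℚ} (hφ : Monotone φ) : Monotone (ratExtend φ) := by
  intro x y hxy
  obtain ⟨q, hq⟩ := exists_rat_lt x
  obtain ⟨r, hr⟩ := exists_rat_gt y
  refine csSup_le_csSup ⟨φ r, ?_⟩ ⟨φ q, q, hq.le, rfl⟩
    (Set.image_mono fun s (hs : (s : ℝ) ≤ x) => hs.trans hxy)
  rintro _ ⟨s, hs, rfl⟩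
  exact Rat.cast_le.2 (hφ (Rat.cast_le.1 (le_trans hs hr.le)))

theorem Monotone.eq_of_eq_ratCast {F : ℝ → ℝ} (hF : Monotone F)
    (h : ∀ q : ℚ, F q = q) (x : ℝ) : F x = x := by
  refine le_antisymm (le_of_forall_gt fun y hy => ?_) (le_of_forall_lt fun y hy => ?_)
  · obtain ⟨q, hxq, hqy⟩ := exists_rat_btwn hy
    exact ((hF hxq.le).trans (h q).le).trans_lt hqy
  · obtain ⟨q, hyq, hqx⟩ := exists_rat_btwn hy
    exact hyq.trans_le ((h q).ge.trans (hF hqx.le))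

theorem ratExtend_comp {φ ψ χ : ℚ ≃o ℚ} (h : ∀ q, χ (φ (ψ q)) = q) (x : ℝ) :
    ratExtend χ (ratExtend φ (ratExtend ψ x)) = x := by
  refine Monotone.eq_of_eq_ratCast (F := fun x => ratExtend χ (ratExtend φ (ratExtend ψ x)))
    ((ratExtend_monotone χ.monotone).comp
      ((ratExtend_monotone φ.monotone).comp (ratExtend_monotone ψ.monotone))) (fun q => ?_) x
  simp only [ratExtend_ratCast χ.monotone, ratExtend_ratCast φ.monotone,
    ratExtend_ratCast ψ.monotone, h]

theorem ratExtend_id (x : ℝ) : ratExtend (OrderIso.refl ℚ) x = x :=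
  (ratExtend_monotone (OrderIso.refl ℚ).monotone).eq_of_eq_ratCast
    (fun q => ratExtend_ratCast (OrderIso.refl ℚ).monotone q) x

/-- Order automorphisms of `ℚ` extend to `ℝ`, functorially. -/
noncomputable def ratExtendHom : (ℚ ≃o ℚ) →* (ℝ ≃o ℝ) where
  toFun φ := Equiv.toOrderIso
    { toFun := ratExtend φ
      invFun := ratExtend φ.symm
      left_inv := fun x => by
        simpa only [ratExtend_id] using
          ratExtend_comp (χ := φ.symm) (φ := φ) (ψ := OrderIso.refl ℚ) (by simp) x
      right_inv := fun x => by
        simpa only [ratExtend_id] using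
          ratExtend_comp (χ := φ) (φ := φ.symm) (ψ := OrderIso.refl ℚ) (by simp) x }
    (ratExtend_monotone φ.monotone) (ratExtend_monotone φ.symm.monotone)
  map_one' := OrderIso.ext <| funext ratExtend_id
  map_mul' φ ψ := by
    refine OrderIso.ext <| funext fun x => ?_
    change ratExtend (φ * ψ : ℚ ≃o ℚ) x = ratExtend φ (ratExtend ψ x)
    have h := ratExtend_comp (χ := (φ * ψ).symm) (φ := φ) (ψ := ψ)
      (fun q => (φ * ψ).symm_apply_apply q) x
    have h' := ratExtend_comp (χ := φ * ψ) (φ := (φ * ψ).symm) (ψ := OrderIso.refl ℚ)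
      (fun q => (φ * ψ).apply_symm_apply q) (ratExtend φ (ratExtend ψ x))
    rw [ratExtend_id] at h'
    rw [← h', h]

theorem ratExtendHom_ratCast (φ : ℚ ≃o ℚ) (q : ℚ) : ratExtendHom φ q = (φ q : ℝ) :=
  ratExtend_ratCast φ.monotone q

/-- Order automorphisms act on the first factor of a lexicographic product. -/
def prodLexLeftHom (X Y : Type*) [LinearOrder X] [LinearOrder Y] :
    (X ≃o X) →* ((X ×ₗ Y) ≃o (X ×ₗ Y)) where
  toFun e := Prod.Lex.prodLexCongr e (OrderIso.refl Y)
  map_one' := rfl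
  map_mul' _ _ := rfl

/-- Conjugation of order automorphisms by an order isomorphism. -/
def OrderIso.conjHom {X Y : Type*} [LE X] [LE Y] (e : X ≃o Y) : (X ≃o X) →* (Y ≃o Y) where
  toFun f := (e.symm.trans f).trans e
  map_one' := OrderIso.ext <| funext fun x => e.apply_symm_apply x
  map_mul' f g := OrderIso.ext <| funext fun x =>
    congrArg (fun z => e (f z)) (e.symm_apply_apply (g (e.symm x))).symm

theorem exists_real_action_of_countable {G X : Type*} [Group G] [LinearOrder X] [Countable X]
    (ρ : G →* (X ≃o X)) (p : X) :
    ∃ (σ : G →* (ℝ ≃o ℝ)) (x : ℝ), ∀ g, σ g x = x ↔ ρ g p = p := by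
  have : Nonempty (X ×ₗ ℚ) := ⟨toLex (p, 0)⟩
  have : Countable (X ×ₗ ℚ) := inferInstanceAs (Countable (X × ℚ))
  obtain ⟨e⟩ := Order.iso_of_countable_dense (X ×ₗ ℚ) ℚ
  refine ⟨ratExtendHom.comp (e.conjHom.comp ((prodLexLeftHom X ℚ).comp ρ)),
    (e (toLex (p, 0)) : ℚ), fun g => ?_⟩
  have h : e.conjHom (prodLexLeftHom X ℚ (ρ g)) (e (toLex (p, 0))) = e (toLex (ρ g p, 0)) :=
    congrArg (fun z => e (prodLexLeftHom X ℚ (ρ g) z)) (e.symm_apply_apply _)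
  simp only [MonoidHom.comp_apply, ratExtendHom_ratCast, h, Rat.cast_inj, e.injective.eq_iff,
    EmbeddingLike.apply_eq_iff_eq, Prod.mk.injEq, and_true]

theorem exists_real_action {G X : Type*} [Group G] [Countable G] [LinearOrder X]
    (ρ : G →* (X ≃o X)) (p : X) :
    ∃ (σ : G →* (ℝ ≃o ℝ)) (x : ℝ), ∀ g, σ g x = x ↔ ρ g p = p := by
  let O : Set X := Set.range fun g => ρ g p
  have hO : ∀ (g : G) (x : X), x ∈ O → ρ g x ∈ O := by
    rintro g _ ⟨h, rfl⟩
    exact ⟨g * h, by simp only [map_mul]; rfl⟩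
  let ρ' : G →* (O ≃o O) :=
    { toFun := fun g => Equiv.toOrderIso
        { toFun := fun x => ⟨ρ g x, hO g x x.2⟩
          invFun := fun x => ⟨ρ g⁻¹ x, hO g⁻¹ x x.2⟩
          left_inv := fun x => Subtype.ext (by
            change ρ g⁻¹ (ρ g x) = x
            rw [← RelIso.mul_apply, ← map_mul, inv_mul_cancel, map_one]; rfl)
          right_inv := fun x => Subtype.ext (by
            change ρ g (ρ g⁻¹ x) = x
            rw [← RelIso.mul_apply, ← map_mul, mul_inv_cancel, map_one]; rfl) }
        (fun x y h => (ρ g).monotone h) (fun x y h => (ρ g⁻¹).monotone h)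
      map_one' := OrderIso.ext <| funext fun x => Subtype.ext (by
        change ρ 1 x = x
        rw [map_one]; rfl)
      map_mul' := fun g h => OrderIso.ext <| funext fun x => Subtype.ext (by
        change ρ (g * h) x = ρ g (ρ h x)
        rw [map_mul]; rfl) }
  have : Countable O := (Set.countable_range _).to_subtype
  obtain ⟨σ, x, h⟩ := exists_real_action_of_countable ρ' ⟨p, 1, by simp only [map_one]; rfl⟩
  exact ⟨σ, x, fun g => (h g).trans Subtype.ext_iff⟩

namespace Monoid.Coprod

variable {A : Type*} {B : Type*} [Group A] [Group B]

/-- The element of the free product represented by a letter. -/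
def ofLetter : A ⊕ B → Coprod A B := Sum.elim inl inr

/-- The element of the free product represented by a word. -/
def ofWord (L : List (A ⊕ B)) : Coprod A B := (L.map ofLetter).prod

/-- A word is reduced if its letters are nontrivial and alternate between the factors. -/
def IsReduced (L : List (A ⊕ B)) : Prop :=
  L.IsChain (fun x y => x.isLeft ≠ y.isLeft) ∧ ∀ x ∈ L, Sum.elim (· ≠ 1) (· ≠ 1) x

@[simp]
theorem ofWord_nil : ofWord ([] : List (A ⊕ B)) = 1 := rfl

@[simp]
theorem ofWord_cons (x : A ⊕ B) (L : List (A ⊕ B)) :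
    ofWord (x :: L) = ofLetter x * ofWord L := rfl

@[simp]
theorem ofWord_append (L M : List (A ⊕ B)) : ofWord (L ++ M) = ofWord L * ofWord M := by
  simp [ofWord]

theorem IsReduced.tail {x : A ⊕ B} {L : List (A ⊕ B)} (h : IsReduced (x :: L)) :
    IsReduced L :=
  ⟨h.1.tail, fun y hy => h.2 y (List.mem_cons_of_mem _ hy)⟩

theorem IsReduced.mono {L M : List (A ⊕ B)} (h : IsReduced M) (hLM : L <:+: M) :
    IsReduced L :=
  ⟨by
    obtain ⟨s, t, rfl⟩ := hLM
    exact h.1.left_of_append.right_of_append, fun y hy => h.2 y (hLM.subset hy)⟩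

theorem IsReduced.cons {x : A ⊕ B} {L : List (A ⊕ B)} (h : IsReduced L)
    (hx : Sum.elim (· ≠ 1) (· ≠ 1) x) (hL : ∀ y ∈ L.head?, x.isLeft ≠ y.isLeft) :
    IsReduced (x :: L) :=
  ⟨List.isChain_cons.2 ⟨hL, h.1⟩, List.forall_mem_cons.2 ⟨hx, h.2⟩⟩

end Monoid.Coprod

/-- The shear of a lexicographic product by a function on the base. -/
def lexShear {X : Type*} [LinearOrder X] (c : X → ℤ) : (X ×ₗ ℤ) ≃o (X ×ₗ ℤ) where
  toFun z := toLex ((ofLex z).1, (ofLex z).2 + c (ofLex z).1)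
  invFun z := toLex ((ofLex z).1, (ofLex z).2 - c (ofLex z).1)
  left_inv z := by simp
  right_inv z := by simp
  map_rel_iff' {y z} := by
    simp only [Equiv.coe_fn_mk, Prod.Lex.le_iff, ofLex_toLex]
    refine or_congr_right (and_congr_right fun h => ?_)
    rw [h, add_le_add_iff_right]

namespace Monoid.Coprod

section twist

variable {A : Type*} {B : Type*} [Group A] [Group B] {X : Type*} [LinearOrder X]

/-- Lift an action on `X` to the lexicographic product `X ×ₗ ℤ`, conjugating the action of each
factor by a shear. -/
def twist (ρ : Coprod A B →* (X ≃o X)) (c : Bool → X → ℤ) :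
    Coprod A B →* ((X ×ₗ ℤ) ≃o (X ×ₗ ℤ)) :=
  lift ((lexShear (c true)).conjHom.comp ((prodLexLeftHom X ℤ).comp (ρ.comp inl)))
    ((lexShear (c false)).conjHom.comp ((prodLexLeftHom X ℤ).comp (ρ.comp inr)))

theorem twist_ofLetter (ρ : Coprod A B →* (X ≃o X)) (c : Bool → X → ℤ) (y : A ⊕ B) (z : X)
    (k : ℤ) :
    twist ρ c (ofLetter y) (toLex (z, k)) = toLex (ρ (ofLetter y) z,
      k - c y.isLeft z + c y.isLeft (ρ (ofLetter y) z)) := by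
  cases y <;> rfl

end twist

universe u v

theorem exists_action_nodup {A : Type u} {B : Type v} [Group A] [Group B]
    [LinearOrder A] [MulRightMono A] [LinearOrder B] [MulRightMono B] (L : List (A ⊕ B))
    (hL : IsReduced L) :
    ∃ (X : Type (max u v)) (_ : LinearOrder X) (ρ : Coprod A B →* (X ≃o X)) (p : X),
      (∀ y : A ⊕ B, Sum.elim (· ≠ 1) (· ≠ 1) y → ∀ x, ρ (ofLetter y) x ≠ x) ∧
      (L.tails.map fun s => ρ (ofWord s) p).Nodup := by
  induction L with
  | nil =>
    let α : A →* (A ≃o A) :=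
      { toFun := fun a => OrderIso.mulRight a⁻¹
        map_one' := OrderIso.ext <| funext fun x => by simp
        map_mul' := fun a b => OrderIso.ext <| funext fun x => by simp [mul_assoc] }
    let β : B →* (B ≃o B) :=
      { toFun := fun a => OrderIso.mulRight a⁻¹
        map_one' := OrderIso.ext <| funext fun x => by simp
        map_mul' := fun a b => OrderIso.ext <| funext fun x => by simp [mul_assoc] }
    let β' : B →* ((A ×ₗ B) ≃o (A ×ₗ B)) :=
      { toFun := fun b => Prod.Lex.prodLexCongr (OrderIso.refl A) (β b)
        map_one' := by rw [map_one]; rfl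
        map_mul' := fun a b => by rw [map_mul]; rfl }
    refine ⟨A ×ₗ B, inferInstance, lift ((prodLexLeftHom A B).comp α) β', toLex (1, 1),
      ?_, by simp⟩
    rintro (a | b) hy x h
    · have : (ofLex x).1 * a⁻¹ = (ofLex x).1 := congrArg (fun z => (ofLex z).1) h
      simp_all
    · have : (ofLex x).2 * b⁻¹ = (ofLex x).2 := congrArg (fun z => (ofLex z).2) h
      simp_all
  | cons x L ih =>
    obtain ⟨X, _, ρ, p, hfree, hnd⟩ := ih hL.tail
    classical
    set q := ρ (ofWord L) p with hq
    let c : Bool → X → ℤ := fun i z => if i = x.isLeft ∧ z = q then 1 else 0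
    have hne : ∀ s, s <:+ L → s ≠ L → ρ (ofWord s) p ≠ q := fun s hs hsL h =>
      hsL (List.inj_on_of_nodup_map hnd ((List.mem_tails _ _).2 hs)
        ((List.mem_tails _ _).2 List.suffix_rfl) h)
    have hold : ∀ s, s <:+ L →
        twist ρ c (ofWord s) (toLex (p, 0)) = toLex (ρ (ofWord s) p, 0) := by
      intro s
      induction s with
      | nil => intro _; simp
      | cons y s ihs =>
        intro hs
        have hs' : s <:+ L := (List.suffix_cons y s).trans hs
        rw [ofWord_cons, map_mul, RelIso.mul_apply, ihs hs', twist_ofLetter, map_mul,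
          RelIso.mul_apply]
        by_cases hyx : y.isLeft = x.isLeft
        · have hsL : y :: s ≠ L := by
            rintro rfl
            exact (List.isChain_cons.1 hL.1).1 y rfl hyx.symm
          have h1 : ρ (ofWord s) p ≠ q := hne s hs' (by
            rintro rfl
            exact absurd hs.length_le (by simp))
          have h2 : ρ (ofLetter y) (ρ (ofWord s) p) ≠ q := by
            simpa using hne _ hs hsL
          simp [c, h1, h2]
        · simp [c, hyx]
    have hnew : twist ρ c (ofWord (x :: L)) (toLex (p, 0)) = toLex (ρ (ofLetter x) q, -1) := by
      have hx : ρ (ofLetter x) q ≠ q := hfree x (hL.2 x List.mem_cons_self) q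
      rw [ofWord_cons, map_mul, RelIso.mul_apply, hold L List.suffix_rfl, twist_ofLetter, ← hq]
      simp [c, hx]
    refine ⟨X ×ₗ ℤ, inferInstance, twist ρ c, toLex (p, 0), fun y hy z hz => ?_, ?_⟩
    · refine hfree y hy (ofLex z).1 ?_
      have := twist_ofLetter ρ c y (ofLex z).1 (ofLex z).2
      exact congrArg (fun z => (ofLex z).1) (this.symm.trans hz)
    · have hmap : (L.tails.map fun s => twist ρ c (ofWord s) (toLex (p, 0))) =
          (L.tails.map fun s => ρ (ofWord s) p).map fun z => toLex (z, (0 : ℤ)) := by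
        rw [List.map_map]
        exact List.map_congr_left fun s hs => hold s ((List.mem_tails _ _).1 hs)
      rw [List.tails_cons, List.map_cons, List.nodup_cons, hmap]
      refine ⟨?_, hnd.map fun y z h => congrArg (fun t => (ofLex t).1) h⟩
      rw [hnew, List.mem_map]
      rintro ⟨z, -, hz⟩
      simpa using congrArg (fun t => (ofLex t).2) hz

variable {A : Type u} {B : Type v} [Group A] [Group B]

theorem exists_isReduced (g : Coprod A B) : ∃ L : List (A ⊕ B), IsReduced L ∧ ofWord L = g := by
  induction g using Coprod.induction_on' with
  | one => exact ⟨[], ⟨List.isChain_nil, by simp⟩, rfl⟩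
  | inl_mul a g ih =>
    obtain ⟨L, hL, rfl⟩ := ih
    by_cases ha : a = 1
    · exact ⟨L, hL, by simp [ha]⟩
    match L, hL with
    | [], hL => exact ⟨[.inl a], hL.cons ha (by simp), rfl⟩
    | .inr b :: L, hL => exact ⟨.inl a :: .inr b :: L, hL.cons ha (by simp), rfl⟩
    | .inl a' :: L, hL =>
      by_cases h : a * a' = 1
      · exact ⟨L, hL.tail, by simp [ofLetter, ← mul_assoc, ← map_mul, h]⟩
      · refine ⟨.inl (a * a') :: L, hL.tail.cons h (List.isChain_cons.1 hL.1).1, ?_⟩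
        simp [ofLetter, mul_assoc]
  | inr_mul b g ih =>
    obtain ⟨L, hL, rfl⟩ := ih
    by_cases hb : b = 1
    · exact ⟨L, hL, by simp [hb]⟩
    match L, hL with
    | [], hL => exact ⟨[.inr b], hL.cons hb (by simp), rfl⟩
    | .inl a :: L, hL => exact ⟨.inr b :: .inl a :: L, hL.cons hb (by simp), rfl⟩
    | .inr b' :: L, hL =>
      by_cases h : b * b' = 1
      · exact ⟨L, hL.tail, by simp [ofLetter, ← mul_assoc, ← map_mul, h]⟩
      · refine ⟨.inr (b * b') :: L, hL.tail.cons h (List.isChain_cons.1 hL.1).1, ?_⟩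
        simp [ofLetter, mul_assoc]

section ordered

variable [LinearOrder A] [MulRightMono A] [LinearOrder B] [MulRightMono B]

theorem exists_action_ne {L : List (A ⊕ B)} (hL : IsReduced L) (hne : L ≠ []) :
    ∃ (X : Type (max u v)) (_ : LinearOrder X) (ρ : Coprod A B →* (X ≃o X)) (p : X),
      ρ (ofWord L) p ≠ p := by
  obtain ⟨X, _, ρ, p, -, hnd⟩ := exists_action_nodup L hL
  refine ⟨X, _, ρ, p, fun h => hne ?_⟩
  exact List.inj_on_of_nodup_map hnd ((List.mem_tails _ _).2 List.suffix_rfl)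
    ((List.mem_tails _ _).2 (List.nil_suffix)) (by simpa using h)

theorem ofWord_ne_one {L : List (A ⊕ B)} (hL : IsReduced L) (hne : L ≠ []) : ofWord L ≠ 1 := by
  obtain ⟨X, _, ρ, p, h⟩ := exists_action_ne hL hne
  rintro h1
  simp [h1] at h

variable (A B) in
theorem exists_linearOrder_mulRightStrictMono :
    ∃ _ : LinearOrder (Coprod A B), MulRightStrictMono (Coprod A B) := by
  have key : ∀ g : Coprod A B, ∃ (X : Type (max u v)) (_ : LinearOrder X)
      (ρ : Coprod A B →* (X ≃o X)) (p : X), ρ g p = p → g = 1 := by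
    intro g
    obtain ⟨L, hL, rfl⟩ := exists_isReduced g
    by_cases hne : L = []
    · exact ⟨A ×ₗ B, inferInstance, 1, toLex (1, 1), fun _ => by simp [hne]⟩
    · obtain ⟨X, _, ρ, p, h⟩ := exists_action_ne hL hne
      exact ⟨X, _, ρ, p, fun h' => absurd h' h⟩
  choose X hX ρ p h using key
  classical
  let : LinearOrder (Coprod A B) := linearOrderOfSTO WellOrderingRel
  have : WellFoundedLT (Coprod A B) := ⟨IsWellFounded.wf (r := WellOrderingRel)⟩
  let f : Coprod A B → Lex (∀ g, X g) := fun x => toLex fun g => ρ g x⁻¹ (p g)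
  have hf : Function.Injective f := by
    intro x y hxy
    have hg := congrFun (congrArg ofLex hxy) (x * y⁻¹)
    have h1 := h (x * y⁻¹) (by
      rw [map_mul, RelIso.mul_apply]
      refine (congrArg _ hg.symm).trans ?_
      change ρ (x * y⁻¹) x (ρ (x * y⁻¹) x⁻¹ (p (x * y⁻¹))) = _
      rw [← RelIso.mul_apply, ← map_mul, mul_inv_cancel, map_one]; rfl)
    exact mul_inv_eq_one.1 h1
  refine ⟨LinearOrder.lift' f hf, ⟨fun z x y hxy => ?_⟩⟩
  obtain ⟨i, hi, hlt⟩ : f x < f y := hxy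
  have hfz : ∀ (x : Coprod A B) j, f (x * z) j = ρ j z⁻¹ (f x j) := by
    intro x j
    change ρ j (x * z)⁻¹ (p j) = ρ j z⁻¹ (ρ j x⁻¹ (p j))
    rw [mul_inv_rev, map_mul, RelIso.mul_apply]
  change f (x * z) < f (y * z)
  refine ⟨i, fun j hj => ?_, ?_⟩
  · exact ((hfz x j).trans (congrArg _ (hi j hj))).trans (hfz y j).symm
  · exact (hfz x i).trans_lt (((ρ i z⁻¹).lt_iff_lt.2 hlt).trans_eq (hfz y i).symm)

end ordered

end Monoid.Coprod

namespace List

theorem exists_eq_flatten_replicate_of_append_comm {α : Type*} {s t : List α}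
    (h : s ++ t = t ++ s) :
    ∃ (r : List α) (i j : ℕ), s = (replicate i r).flatten ∧ t = (replicate j r).flatten := by
  induction hn : s.length + t.length using Nat.strong_induction_on generalizing s t with
  | _ n ih =>
  wlog hst : s.length ≤ t.length generalizing s t
  · obtain ⟨r, i, j, hi, hj⟩ := this h.symm (by omega) (by omega)
    exact ⟨r, j, i, hj, hi⟩
  rcases eq_or_ne s [] with rfl | hs
  · exact ⟨t, 0, 1, by simp, by simp⟩
  obtain ⟨t', rfl⟩ : s <+: t := prefix_of_prefix_length_le ⟨t, rfl⟩ ⟨s, h.symm⟩ hst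
  have hpos := length_pos_iff.2 hs
  rw [length_append] at hn
  obtain ⟨r, i, j, hi, hj⟩ := ih (s.length + t'.length) (by omega)
    (by simpa [append_assoc] using h : s ++ t' = t' ++ s) rfl
  exact ⟨r, i, i + j, hi, by rw [replicate_add, flatten_append, ← hi, ← hj]⟩

end List

namespace Monoid.Coprod

variable {A : Type u} {B : Type v} [Group A] [Group B]

theorem ofWord_flatten_replicate (n : ℕ) (L : List (A ⊕ B)) :
    ofWord (List.replicate n L).flatten = ofWord L ^ n := by
  induction n with
  | zero => simp
  | succ n ih => rw [List.replicate_succ, List.flatten_cons, ofWord_append, ih, pow_succ']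

/-- The formal inverse of a word. -/
def invWord (L : List (A ⊕ B)) : List (A ⊕ B) :=
  (L.map (Sum.map (·⁻¹) (·⁻¹))).reverse

@[simp]
theorem invWord_append (L M : List (A ⊕ B)) : invWord (L ++ M) = invWord M ++ invWord L := by
  simp [invWord]

@[simp]
theorem ofWord_invWord (L : List (A ⊕ B)) : ofWord (invWord L) = (ofWord L)⁻¹ := by
  induction L with
  | nil => simp [invWord]
  | cons x L ih =>
    rw [← List.singleton_append, invWord_append, ofWord_append, ih]
    cases x <;> simp [invWord, ofLetter]

@[simp]
theorem length_invWord (L : List (A ⊕ B)) : (invWord L).length = L.length := by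
  simp [invWord]

theorem IsReduced.invWord {L : List (A ⊕ B)} (h : IsReduced L) : IsReduced (invWord L) := by
  refine ⟨?_, fun x hx => ?_⟩
  · rw [Coprod.invWord, List.isChain_reverse, List.isChain_map]
    simpa [ne_comm] using h.1
  · simp only [Coprod.invWord, List.mem_reverse, List.mem_map] at hx
    obtain ⟨y, hy, rfl⟩ := hx
    have := h.2 y hy
    cases y <;> simpa using this

theorem IsReduced.append {L M : List (A ⊕ B)} (hL : IsReduced L) (hM : IsReduced M)
    (h : ∀ x ∈ L.getLast?, ∀ y ∈ M.head?, x.isLeft ≠ y.isLeft) : IsReduced (L ++ M) :=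
  ⟨List.isChain_append.2 ⟨hL.1, hM.1, h⟩, fun x hx =>
    (List.mem_append.1 hx).elim (hL.2 x) (hM.2 x)⟩

theorem IsReduced.invWord_append_cons {x y z : A ⊕ B} {L M : List (A ⊕ B)}
    (hL : IsReduced (x :: L)) (hM : IsReduced (y :: M)) (hz : Sum.elim (· ≠ 1) (· ≠ 1) z)
    (hxz : x.isLeft = z.isLeft) (hyz : y.isLeft = z.isLeft) :
    IsReduced (Coprod.invWord L ++ z :: M) := by
  refine hL.tail.invWord.append (hM.tail.cons hz ?_) ?_
  · rw [← hyz]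
    exact (List.isChain_cons.1 hM.1).1
  · simp only [Coprod.invWord, List.getLast?_reverse, List.head?_map, List.head?_cons]
    have := (List.isChain_cons.1 hL.1).1
    rintro _ hw _ ⟨⟩
    obtain ⟨w, hwL, rfl⟩ := Option.mem_map.1 hw
    simpa [← hxz, ne_comm] using this w hwL

section ordered

variable [LinearOrder A] [MulRightMono A] [LinearOrder B] [MulRightMono B]

theorem IsReduced.eq_of_ofWord_eq {L M : List (A ⊕ B)} (hL : IsReduced L) (hM : IsReduced M)
    (h : ofWord L = ofWord M) : L = M := by
  induction L generalizing M with
  | nil =>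
    by_contra hne
    exact ofWord_ne_one hM (Ne.symm hne) h.symm
  | cons x L ih =>
    rcases M with - | ⟨y, M⟩
    · exact absurd h (ofWord_ne_one hL (by simp))
    by_cases hxy : x = y
    · subst hxy
      rw [ih hL.tail hM.tail (mul_left_cancel h)]
    have hne : ∀ z : A ⊕ B, Sum.elim (· ≠ 1) (· ≠ 1) z → x.isLeft = z.isLeft →
        y.isLeft = z.isLeft → ofLetter z ≠ (ofLetter x)⁻¹ * ofLetter y := by
      intro z hz hxz hyz hzz
      refine ofWord_ne_one (hL.invWord_append_cons hM hz hxz hyz) (by simp) ?_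
      rw [ofWord_cons, ofWord_cons] at h
      rw [ofWord_append, ofWord_cons, hzz, ofWord_invWord, mul_assoc, ← h]
      group
    have hdiff : x.isLeft ≠ y.isLeft → False := by
      intro hlr
      refine ofWord_ne_one (L := Coprod.invWord (x :: L) ++ y :: M)
        (hL.invWord.append hM ?_) (by simp) (by simp [h])
      rintro w hw _ ⟨⟩
      have : w = Sum.map (·⁻¹) (·⁻¹) x := by simpa [Coprod.invWord, eq_comm] using hw
      simpa [this] using hlr
    rcases x with a | b <;> rcases y with a' | b'
    · refine absurd ?_ (hne (.inl (a⁻¹ * a')) ?_ rfl rfl)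
      · simp [ofLetter]
      · simpa [inv_mul_eq_one] using hxy
    · exact (hdiff (by simp)).elim
    · exact (hdiff (by simp)).elim
    · refine absurd ?_ (hne (.inr (b⁻¹ * b')) ?_ rfl rfl)
      · simp [ofLetter]
      · simpa [inv_mul_eq_one] using hxy

end ordered

end Monoid.Coprod

theorem eq_one_of_mul_self_eq_one {G : Type*} [Group G] [LinearOrder G] [MulRightStrictMono G]
    {g : G} (h : g * g = 1) : g = 1 := by
  rcases lt_trichotomy g 1 with hg | hg | hg
  · have := mul_lt_mul_left hg g
    rw [h, one_mul] at this
    exact absurd this hg.asymm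
  · exact hg
  · have := mul_lt_mul_left hg g
    rw [h, one_mul] at this
    exact absurd this hg.asymm

theorem List.flatten_replicate_append_comm {α : Type*} (k : ℕ) (s t : List α) :
    s ++ (replicate k (t ++ s)).flatten ++ t = (replicate (k + 1) (s ++ t)).flatten := by
  induction k with
  | zero => simp
  | succ k ih =>
    rw [replicate_succ, flatten_cons, replicate_succ (n := k + 1), flatten_cons, ← ih]
    simp

namespace Monoid.Coprod

section cyclic

variable {A : Type u} {B : Type v} [Group A] [Group B]

/-- A word is cyclically reduced if all its powers are reduced. -/
def IsCyclicallyReduced (L : List (A ⊕ B)) : Prop :=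
  ∀ k, IsReduced (List.replicate k L).flatten

theorem IsCyclicallyReduced.isReduced {L : List (A ⊕ B)} (h : IsCyclicallyReduced L) :
    IsReduced L := by
  simpa using h 1

theorem IsCyclicallyReduced.append_comm {s t : List (A ⊕ B)}
    (h : IsCyclicallyReduced (s ++ t)) : IsCyclicallyReduced (t ++ s) := fun k =>
  (h (k + 1)).mono ⟨s, t, List.flatten_replicate_append_comm k s t⟩

theorem conj_ofWord_append (s t : List (A ⊕ B)) :
    (ofWord s)⁻¹ * ofWord (s ++ t) * ofWord s = ofWord (t ++ s) := by
  simp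

end cyclic

end Monoid.Coprod

namespace Monoid.Coprod

variable {A : Type u} {B : Type v} [Group A] [Group B]
variable [LinearOrder A] [MulRightMono A] [LinearOrder B] [MulRightMono B]

theorem pow_ofWord_append_ne {s t : List (A ⊕ B)} (hs : s ≠ []) (ht : t ≠ [])
    (hst : IsCyclicallyReduced (s ++ t))
    (hpow : ∀ (v : Coprod A B) (j : ℕ), 2 ≤ j → ofWord (s ++ t) ≠ v ^ j)
    {p : ℕ} (hp : p ≠ 0) (q : ℤ) : ofWord (s ++ t) ^ p ≠ ofWord (t ++ s) ^ q := by
  intro h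
  have hts := hst.append_comm
  have hs0 := List.length_pos_iff.2 hs
  have ht0 := List.length_pos_iff.2 ht
  have hlen : ∀ L M : List (A ⊕ B), ∀ k : ℕ, L.length = s.length + t.length →
      M.length = s.length + t.length →
      (List.replicate p L).flatten = (List.replicate k M).flatten → L = M := by
    intro L M k hL hM hLM
    have hl := congrArg List.length hLM
    simp only [List.length_flatten, List.map_replicate, List.sum_replicate, hL, hM,
      smul_eq_mul] at hl
    obtain rfl := Nat.eq_of_mul_eq_mul_right (by omega) hl
    obtain ⟨p, rfl⟩ := Nat.exists_eq_succ_of_ne_zero hp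
    rw [List.replicate_succ, List.replicate_succ, List.flatten_cons, List.flatten_cons] at hLM
    exact List.append_inj_left hLM (hL.trans hM.symm)
  obtain ⟨k, rfl | rfl⟩ := q.eq_nat_or_neg
  · rw [zpow_natCast, ← ofWord_flatten_replicate, ← ofWord_flatten_replicate] at h
    have hcomm := hlen _ _ k (by simp) (by simp [add_comm]) ((hst p).eq_of_ofWord_eq (hts k) h)
    obtain ⟨r, i, j, rfl, rfl⟩ := List.exists_eq_flatten_replicate_of_append_comm hcomm
    have hi : i ≠ 0 := by rintro rfl; simp at hs
    have hj : j ≠ 0 := by rintro rfl; simp at ht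
    refine hpow (ofWord r) (i + j) (by omega) ?_
    rw [ofWord_append, ofWord_flatten_replicate, ofWord_flatten_replicate, pow_add]
  · have hinv : invWord (List.replicate k (t ++ s)).flatten =
        (List.replicate k (invWord (t ++ s))).flatten := by
      simp only [invWord, List.map_flatten, List.reverse_flatten, List.map_replicate,
        List.reverse_replicate]
    rw [zpow_neg, zpow_natCast, ← ofWord_flatten_replicate, ← ofWord_flatten_replicate,
      ← ofWord_invWord] at h
    have heq := (hst p).eq_of_ofWord_eq (hts k).invWord h
    rw [hinv] at heq
    have heq := hlen _ _ k (by simp) (by simp) heq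
    rw [invWord_append] at heq
    have hss : s = invWord s := List.append_inj_left heq (by simp)
    obtain ⟨_, _⟩ := exists_linearOrder_mulRightStrictMono A B
    have hone : ofWord s = 1 := eq_one_of_mul_self_eq_one (by
      nth_rewrite 2 [hss]
      rw [ofWord_invWord, mul_inv_cancel])
    refine ofWord_ne_one ((hst 1).mono ?_) hs hone
    simpa using (List.prefix_append s t).isInfix

theorem zpow_ofWord_append_ne {s t : List (A ⊕ B)} (hs : s ≠ []) (ht : t ≠ [])
    (hst : IsCyclicallyReduced (s ++ t))
    (hpow : ∀ (v : Coprod A B) (j : ℕ), 2 ≤ j → ofWord (s ++ t) ≠ v ^ j)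
    {p : ℤ} (hp : p ≠ 0) (q : ℤ) : ofWord (s ++ t) ^ p ≠ ofWord (t ++ s) ^ q := by
  intro h
  obtain ⟨k, rfl | rfl⟩ := p.eq_nat_or_neg
  · exact pow_ofWord_append_ne hs ht hst hpow (by simpa using hp) q (by simpa using h)
  · refine pow_ofWord_append_ne hs ht hst hpow (p := k) (by simpa using hp) (-q) ?_
    rw [zpow_neg, ← h]
    simp

theorem conj_zpow_ofWord_ne {L : List (A ⊕ B)} (hL : IsCyclicallyReduced L)
    (hpow : ∀ (v : Coprod A B) (j : ℕ), 2 ≤ j → ofWord L ≠ v ^ j)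
    {m₁ m₂ : ℕ} (h₁₂ : m₁ < m₂) (h₂ : m₂ ≤ L.length) (h : 1 ≤ m₁ ∨ m₂ < L.length)
    {p : ℤ} (hp : p ≠ 0) (q : ℤ) :
    (ofWord (L.take m₁))⁻¹ * ofWord L ^ p * ofWord (L.take m₁) ≠
      (ofWord (L.take m₂))⁻¹ * ofWord L ^ q * ofWord (L.take m₂) := by
  obtain ⟨x, s, y, rfl, rfl, rfl⟩ : ∃ x s y, L = x ++ (s ++ y) ∧ m₁ = x.length ∧
      m₂ = (x ++ s).length := by
    refine ⟨L.take m₁, (L.drop m₁).take (m₂ - m₁), L.drop m₂, ?_, ?_, ?_⟩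
    · conv_lhs => rw [← List.take_append_drop m₁ L, ← List.take_append_drop (m₂ - m₁) (L.drop m₁)]
      rw [List.drop_drop, Nat.add_sub_cancel' h₁₂.le]
    · rw [List.length_take]; omega
    · simp only [List.length_append, List.length_take, List.length_drop]; omega
  simp only [List.length_append] at h₁₂ h
  have hs : s ≠ [] := by rintro rfl; simp at h₁₂
  have ht : y ++ x ≠ [] := by
    intro h0
    obtain ⟨rfl, rfl⟩ := List.append_eq_nil_iff.1 h0
    simp at h
  have hcyc : IsCyclicallyReduced (s ++ (y ++ x)) := by
    rw [← List.append_assoc]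
    exact hL.append_comm
  have hconj : ∀ (u v : List (A ⊕ B)) (k : ℤ),
      (ofWord u)⁻¹ * ofWord (u ++ v) ^ k * ofWord u = ofWord (v ++ u) ^ k := by
    intro u v k
    have h0 := conj_zpow (i := k) (a := (ofWord u)⁻¹) (b := ofWord (u ++ v))
    rw [inv_inv] at h0
    rw [← h0, conj_ofWord_append]
  rw [List.take_left, ← List.append_assoc x s y, List.take_left, hconj, List.append_assoc x s y,
    hconj, List.append_assoc, ← List.append_assoc y x s]
  refine zpow_ofWord_append_ne hs ht hcyc (fun v j hj hv => ?_) hp q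
  refine hpow (ofWord x * v * (ofWord x)⁻¹) j hj ?_
  rw [conj_pow, ← hv, ← List.append_assoc s y x, ← conj_ofWord_append x (s ++ y)]
  group

end Monoid.Coprod

namespace HahnSeries

variable {G : Type*} [Group G] [LinearOrder G] [MulRightStrictMono G]

/-- Translation of the exponents of a Hahn series by right multiplication. -/
def shift (g : G) : HahnSeries G ℤ →+ HahnSeries G ℤ where
  toFun f :=
    { coeff := fun x => f.coeff (x * g)
      isPWO_support' := by
        have hg : StrictMono (fun x => x * g⁻¹) := fun _ _ h => mul_lt_mul_left h _
        refine (f.isPWO_support.image_of_monotone hg.monotone).mono ?_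
        exact fun x hx => ⟨x * g, hx, mul_inv_cancel_right x g⟩ }
  map_zero' := rfl
  map_add' _ _ := rfl

@[simp]
theorem coeff_shift (g : G) (f : HahnSeries G ℤ) (x : G) :
    (shift g f).coeff x = f.coeff (x * g) := rfl

@[simp]
theorem shift_one (f : HahnSeries G ℤ) : shift 1 f = f := by
  ext x
  simp

theorem shift_mul (g h : G) (f : HahnSeries G ℤ) : shift (g * h) f = shift g (shift h f) := by
  ext x
  simp [mul_assoc]

theorem shift_single (g x : G) : shift g (single x (1 : ℤ)) = single (x * g⁻¹) 1 := by
  ext y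
  simp [coeff_single, eq_mul_inv_iff_mul_eq]

variable (G) in
/-- The action of `G` on Hahn series by translation of exponents. -/
noncomputable def shiftHom : G →* (Lex (HahnSeries G ℤ) ≃o Lex (HahnSeries G ℤ)) where
  toFun g := StrictMono.orderIsoOfRightInverse (fun f => toLex (shift g (ofLex f)))
    (fun f₁ f₂ h => by
      obtain ⟨i, hi, hlt⟩ := (HahnSeries.lt_iff _ _).1 h
      refine (HahnSeries.lt_iff _ _).2 ⟨i * g⁻¹, fun j hj => hi _ ?_, by simpa using hlt⟩
      simpa using mul_lt_mul_left hj g)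
    (fun f => toLex (shift g⁻¹ (ofLex f)))
    (fun f => by simp [← shift_mul])
  map_one' := OrderIso.ext <| funext fun f => shift_one f
  map_mul' g h := OrderIso.ext <| funext fun f => shift_mul g h f

theorem zpow_strictMono_or_strictAnti {w : G} (hw : w ≠ 1) (x : G) :
    StrictMono (fun k : ℤ => x * w ^ k) ∨ StrictAnti (fun k : ℤ => x * w ^ k) := by
  have h : ∀ k : ℤ, x * w ^ (k + 1) = x * w * x⁻¹ * (x * w ^ k) := by
    intro k
    rw [zpow_add_one, (Commute.refl w).zpow_left k |>.eq]
    group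
  rcases lt_trichotomy (x * w * x⁻¹) 1 with hlt | heq | hgt
  · refine .inr (strictAnti_int_of_succ_lt fun k => ?_)
    rw [h]
    simpa using mul_lt_mul_left hlt (x * w ^ k)
  · exact absurd (by simpa using heq) hw
  · refine .inl (strictMono_int_of_lt_succ fun k => ?_)
    rw [h]
    simpa using mul_lt_mul_left hgt (x * w ^ k)

theorem zpow_injective_of_ne_one {w : G} (hw : w ≠ 1) :
    Function.Injective (fun k : ℤ => w ^ k) := by
  have := zpow_strictMono_or_strictAnti hw 1
  simp only [one_mul] at this
  exact this.elim StrictMono.injective StrictAnti.injective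

open Classical in
theorem exists_sub_shift_eq_single {w : G} (hw : w ≠ 1) (x : G) :
    ∃ f : HahnSeries G ℤ, f - shift w f = single x 1 ∧
      (∀ y, f.coeff y ≠ 0 → ∃ k : ℤ, y = x * w ^ k) ∧
      {k : ℤ | f.coeff (x * w ^ k) ≠ 0}.Infinite := by
  have hinj : Function.Injective (fun k : ℤ => x * w ^ k) :=
    fun k l h => zpow_injective_of_ne_one hw (mul_left_cancel h)
  suffices ∃ (s : Set ℤ) (c : ℤ), c ≠ 0 ∧ s.Infinite ∧
      ((fun k : ℤ => x * w ^ k) '' s).IsPWO ∧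
      ∀ k, ((if k ∈ s then c else 0) - if k + 1 ∈ s then c else 0) = if k = 0 then 1 else 0 by
    obtain ⟨s, c, hc, hs, hpwo, h⟩ := this
    let f : HahnSeries G ℤ :=
      { coeff := fun y => if y ∈ (fun k : ℤ => x * w ^ k) '' s then c else 0
        isPWO_support' := hpwo.mono fun y hy => by
          by_contra hy'
          exact hy (if_neg hy') }
    have hf : ∀ k : ℤ, f.coeff (x * w ^ k) = if k ∈ s then c else 0 := fun k => by
      simp only [f, hinj.mem_set_image]
    have hsupp : ∀ y, f.coeff y ≠ 0 → ∃ k : ℤ, y = x * w ^ k := by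
      intro y hy
      by_contra hy'
      refine hy (if_neg ?_)
      rintro ⟨k, -, rfl⟩
      exact hy' ⟨k, rfl⟩
    refine ⟨f, ?_, hsupp, ?_⟩
    · ext y
      rw [coeff_sub, coeff_shift, coeff_single]
      by_cases hy : ∃ k : ℤ, y = x * w ^ k
      · obtain ⟨k, rfl⟩ := hy
        rw [mul_assoc, ← zpow_add_one, hf, hf, h]
        simp [← (zpow_injective_of_ne_one hw).eq_iff (a := k) (b := 0)]
      · have h1 : f.coeff y = 0 := by
          by_contra hne
          exact hy (hsupp y hne)
        have h2 : f.coeff (y * w) = 0 := by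
          by_contra hne
          obtain ⟨k, hk⟩ := hsupp _ hne
          exact hy ⟨k - 1, by rw [zpow_sub_one, ← mul_assoc, ← hk, mul_inv_cancel_right]⟩
        rw [h1, h2, if_neg, sub_zero]
        rintro rfl
        exact hy ⟨0, by simp⟩
    · refine hs.mono fun k hk => ?_
      change f.coeff _ ≠ 0
      rwa [hf, if_pos hk]
  rcases zpow_strictMono_or_strictAnti hw x with hmono | hanti
  · refine ⟨Set.Ici 1, -1, by simp, Set.Ici_infinite 1, ?_, fun k => ?_⟩
    · exact (BddBelow.isWF ⟨1, fun _ h => h⟩).isPWO.image_of_monotone hmono.monotone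
    · simp only [Set.mem_Ici]
      grind
  · refine ⟨Set.Iic 0, 1, by simp, Set.Iic_infinite 0, ?_, fun k => ?_⟩
    · have : (Set.Ici (0 : ℤ)).IsPWO := (BddBelow.isWF ⟨0, fun _ h => h⟩).isPWO
      refine (this.image_of_monotone (hanti.comp (fun a b => neg_lt_neg)).monotone).mono ?_
      rintro _ ⟨k, hk, rfl⟩
      exact ⟨-k, by simpa using hk, by simp⟩
    · simp only [Set.mem_Iic]
      grind

theorem exists_sub_shift_eq_of_mem_closure {w : G} (hw : w ≠ 1) {P : Set G}
    {d : HahnSeries G ℤ} (hd : d ∈ AddSubgroup.closure ((single · (1 : ℤ)) '' P)) :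
    ∃ f : HahnSeries G ℤ, f - shift w f = d ∧
      ∀ y, f.coeff y ≠ 0 → ∃ x ∈ P, ∃ k : ℤ, y = x * w ^ k := by
  induction hd using AddSubgroup.closure_induction with
  | mem _ h =>
    obtain ⟨x, hx, rfl⟩ := h
    obtain ⟨f, hf, hsupp, -⟩ := exists_sub_shift_eq_single hw x
    exact ⟨f, hf, fun y hy => ⟨x, hx, hsupp y hy⟩⟩
  | zero => exact ⟨0, by simp, by simp⟩
  | add _ _ _ _ h₁ h₂ =>
    obtain ⟨f₁, rfl, h₁⟩ := h₁
    obtain ⟨f₂, rfl, h₂⟩ := h₂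
    refine ⟨f₁ + f₂, by rw [map_add]; abel, fun y hy => ?_⟩
    by_cases hy₁ : f₁.coeff y = 0
    · exact h₂ y (by simpa [hy₁] using hy)
    · exact h₁ y hy₁
  | neg _ _ h =>
    obtain ⟨f, rfl, h⟩ := h
    exact ⟨-f, by rw [map_neg]; abel, fun y hy => h y (by simpa using hy)⟩

end HahnSeries

namespace Monoid.Coprod

open HahnSeries

section affine

variable {A : Type u} {B : Type v} [Group A] [Group B]
  [LinearOrder (Coprod A B)] [MulRightStrictMono (Coprod A B)]

variable (A B) in
/-- The action of the free product on Hahn series for which `A` acts by translation of exponents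
and `B` acts by the conjugate of this action that fixes the monomial with exponent `1`. -/
noncomputable def affineHom :
    Coprod A B →* (Lex (HahnSeries (Coprod A B) ℤ) ≃o Lex (HahnSeries (Coprod A B) ℤ)) :=
  lift ((shiftHom _).comp inl)
    ((OrderIso.addRight (toLex (single 1 1))).conjHom.comp ((shiftHom _).comp inr))

/-- The translation part of the affine action on Hahn series. -/
noncomputable def affineCocycle (g : Coprod A B) : HahnSeries (Coprod A B) ℤ :=
  ofLex (affineHom A B g 0)

theorem affineHom_inl (a : A) (f : HahnSeries (Coprod A B) ℤ) :
    affineHom A B (inl a) (toLex f) = toLex (shift (inl a) f) := rfl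

theorem affineHom_inr (b : B) (f : HahnSeries (Coprod A B) ℤ) :
    affineHom A B (inr b) (toLex f) =
      toLex (shift (inr b) f + (single 1 1 - single (inr b)⁻¹ 1)) := by
  have h : affineHom A B (inr b) (toLex f) =
      toLex (shift (inr b) (f + -single 1 1) + single 1 1) := rfl
  rw [h, map_add (shift _), map_neg, shift_single, one_mul]
  congr 1
  abel

theorem affineHom_toLex (g : Coprod A B) (f : HahnSeries (Coprod A B) ℤ) :
    affineHom A B g (toLex f) = toLex (shift g f + affineCocycle g) := by
  have key : ∀ g, ∃ d, ∀ f, affineHom A B g (toLex f) = toLex (shift g f + d) := by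
    intro g
    induction g using Coprod.induction_on with
    | inl a => exact ⟨0, fun f => by rw [affineHom_inl, add_zero]⟩
    | inr b => exact ⟨_, affineHom_inr b⟩
    | mul g h hg hh =>
      obtain ⟨d, hd⟩ := hg
      obtain ⟨e, he⟩ := hh
      refine ⟨shift g e + d, fun f => ?_⟩
      rw [map_mul, RelIso.mul_apply, he, hd, shift_mul, map_add (shift g), add_assoc]
  obtain ⟨d, hd⟩ := key g
  have h0 : affineCocycle g = d := by
    change ofLex (affineHom A B g (toLex 0)) = d
    rw [hd, map_zero, zero_add, ofLex_toLex]
  rw [hd, h0]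

theorem affineCocycle_mul (g h : Coprod A B) :
    affineCocycle (g * h) = shift g (affineCocycle h) + affineCocycle g := by
  have := affineHom_toLex (A := A) (B := B) g (affineCocycle h)
  rw [← toLex_inj, ← this, affineCocycle, affineCocycle, map_mul]
  rfl

theorem affineCocycle_inl (a : A) : affineCocycle (inl a : Coprod A B) = 0 := by
  have := affineHom_inl (B := B) a 0
  rw [affineHom_toLex, toLex_inj] at this
  simpa using this

theorem affineCocycle_inr (b : B) :
    affineCocycle (inr b : Coprod A B) = single 1 1 - single (inr b)⁻¹ 1 := by
  have := affineHom_inr (A := A) b 0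
  rw [affineHom_toLex, toLex_inj] at this
  simpa using this

theorem affineCocycle_mul_inr (g : Coprod A B) (b : B) :
    affineCocycle (g * inr b) = affineCocycle g + single g⁻¹ 1 - single (g * inr b)⁻¹ 1 := by
  rw [affineCocycle_mul, affineCocycle_inr, map_sub, shift_single, shift_single, mul_inv_rev,
    one_mul]
  abel

theorem affineCocycle_mem_closure (a : A) (L : List (A ⊕ B)) :
    affineCocycle (ofWord (.inl a :: L)) ∈ AddSubgroup.closure ((single · (1 : ℤ)) ''
      {x | ∃ P, P <+: .inl a :: L ∧ P ≠ [] ∧ x = (ofWord P)⁻¹}) := by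
  induction L using List.reverseRecOn with
  | nil =>
    have : ofWord [(.inl a : A ⊕ B)] = inl a := by simp [ofLetter]
    rw [this, affineCocycle_inl]
    exact zero_mem _
  | append_singleton L x ih =>
    rw [← List.cons_append]
    have hsub : {x | ∃ P, P <+: .inl a :: L ∧ P ≠ [] ∧ x = (ofWord P)⁻¹} ⊆
        {y | ∃ P, P <+: .inl a :: L ++ [x] ∧ P ≠ [] ∧ y = (ofWord P)⁻¹} := by
      rintro y ⟨P, hP, h⟩
      exact ⟨P, hP.trans (List.prefix_append _ _), h⟩
    have ih' := AddSubgroup.closure_mono (Set.image_mono (f := (single · (1 : ℤ))) hsub) ih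
    rw [ofWord_append, ofWord_cons x, ofWord_nil, mul_one]
    rcases x with c | b
    · rw [affineCocycle_mul]
      simpa [ofLetter, affineCocycle_inl] using ih'
    · change affineCocycle (_ * inr b) ∈ _
      rw [affineCocycle_mul_inr]
      refine sub_mem (add_mem ih' ?_) ?_
      · exact AddSubgroup.subset_closure ⟨_, ⟨_, List.prefix_append _ _, by simp, rfl⟩, rfl⟩
      · exact AddSubgroup.subset_closure ⟨_, ⟨_, List.prefix_rfl, by simp,
          by simp [ofLetter, mul_assoc]⟩, rfl⟩

theorem affineCocycle_support_finite (g : Coprod A B) : (affineCocycle g).support.Finite := by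
  induction g using Coprod.induction_on with
  | inl a => simp [affineCocycle_inl]
  | inr b =>
    rw [affineCocycle_inr]
    exact ((Set.finite_singleton _).union (Set.finite_singleton _)).subset
      ((support_sub_subset _ _).trans
        (Set.union_subset_union support_single_subset support_single_subset))
  | mul g h hg hh =>
    rw [affineCocycle_mul]
    refine ((hh.preimage ((mul_left_injective g).injOn)).union hg).subset (support_add_subset _ _)

end affine

end Monoid.Coprod

namespace Monoid.Coprod

open HahnSeries

section fixed

variable {A : Type u} {B : Type v} [Group A] [Group B]
  [LinearOrder (Coprod A B)] [MulRightStrictMono (Coprod A B)]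

theorem exists_affineHom_fixed (a : A) (b : B) (L : List (A ⊕ B))
    (hw : ofWord (.inl a :: L ++ [.inr b]) ≠ 1)
    (hP : ∀ P, P <+: .inl a :: L → P ≠ [] → ∀ k : ℤ,
      ofWord P ≠ ofWord (.inl a :: L ++ [.inr b]) ^ k) :
    ∃ f : HahnSeries (Coprod A B) ℤ,
      affineHom A B (ofWord (.inl a :: L ++ [.inr b])) (toLex f) = toLex f ∧
      {k : ℤ | f.coeff (ofWord (.inl a :: L ++ [.inr b]) ^ k) ≠ 0}.Infinite ∧
      ∀ y, f.coeff y ≠ 0 → ∃ P, P <+: .inl a :: L ++ [.inr b] ∧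
        ∃ k : ℤ, y = (ofWord P)⁻¹ * ofWord (.inl a :: L ++ [.inr b]) ^ k := by
  set w := ofWord (.inl a :: L ++ [.inr b]) with hwdef
  obtain ⟨f₁, hf₁, hs₁⟩ := exists_sub_shift_eq_of_mem_closure hw
    (add_mem (affineCocycle_mem_closure a L)
      (AddSubgroup.subset_closure ⟨_, ⟨_, List.prefix_rfl, by simp, rfl⟩, rfl⟩))
  obtain ⟨f₂, hf₂, hs₂, hinf⟩ := exists_sub_shift_eq_single hw w⁻¹
  have hc : affineCocycle w = affineCocycle (ofWord (.inl a :: L)) +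
      single (ofWord (.inl a :: L))⁻¹ 1 - single w⁻¹ 1 := by
    have : w = ofWord (.inl a :: L) * inr b := by
      rw [hwdef, ofWord_append, ofWord_cons (.inr b), ofWord_nil, mul_one]
      rfl
    rw [this, affineCocycle_mul_inr]
  refine ⟨f₁ - f₂, ?_, ?_, fun y hy => ?_⟩
  · rw [affineHom_toLex, hc, map_sub, ← hf₁, ← hf₂]
    congr 1
    abel
  · have hinf' := hinf.image (f := fun k : ℤ => k - 1) (sub_left_injective.injOn)
    refine hinf'.mono ?_
    rintro _ ⟨k, hk, rfl⟩
    have h₁ : f₁.coeff (w ^ (k - 1)) = 0 := by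
      by_contra hne
      obtain ⟨_, ⟨P, hP1, hP2, rfl⟩, j, hj⟩ := hs₁ _ hne
      refine hP P hP1 hP2 (j - (k - 1)) ?_
      rw [zpow_sub, hj]
      group
    have h₂ : w ^ (k - 1) = w⁻¹ * w ^ k := by group
    rw [Set.mem_ofPred_eq, coeff_sub, h₁, zero_sub, h₂]
    exact neg_ne_zero.2 hk
  · by_cases hy₁ : f₁.coeff y = 0
    · obtain ⟨k, rfl⟩ := hs₂ y (by simpa [hy₁] using hy)
      exact ⟨_, List.prefix_rfl, k, rfl⟩
    · obtain ⟨_, ⟨P, hP1, -, rfl⟩, k, rfl⟩ := hs₁ y hy₁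
      exact ⟨P, hP1.trans (List.prefix_append _ _), k, rfl⟩

theorem exists_zpow_conj_of_affineHom_fixed {f : HahnSeries (Coprod A B) ℤ}
    {w u : Coprod A B} (hw : w ≠ 1) {T : Set (Coprod A B)} (hT : T.Finite)
    (hinf : {k : ℤ | f.coeff (w ^ k) ≠ 0}.Infinite)
    (hsupp : ∀ y, f.coeff y ≠ 0 → ∃ x ∈ T, ∃ k : ℤ, y = x * w ^ k)
    (hu : affineHom A B u (toLex f) = toLex f) :
    ∃ p q : ℤ, p ≠ 0 ∧ u⁻¹ * w ^ p * u = w ^ q := by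
  rw [affineHom_toLex, toLex_inj] at hu
  have hcoeff : ∀ k : ℤ,
      f.coeff (w ^ k) = f.coeff (w ^ k * u) + (affineCocycle u).coeff (w ^ k) := by
    intro k
    conv_lhs => rw [← hu]
    simp
  have hfin := (affineCocycle_support_finite u).preimage
    ((zpow_injective_of_ne_one hw).injOn)
  have hinf' := hinf.sdiff hfin
  have hex : ∀ k ∈ {k : ℤ | f.coeff (w ^ k) ≠ 0} \ (fun k : ℤ => w ^ k) ⁻¹'
      (affineCocycle u).support, ∃ x ∈ T, ∃ m : ℤ, w ^ k * u = x * w ^ m := by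
    rintro k ⟨hk, hk'⟩
    refine hsupp _ fun h0 => hk ?_
    rw [hcoeff, h0, zero_add]
    by_contra h1
    exact hk' h1
  choose! g hgT m hg using hex
  obtain ⟨k, hk, l, hl, hkl, hgkl⟩ := hinf'.exists_ne_map_eq_of_mapsTo (fun k hk => hgT k hk) hT
  refine ⟨-k + l, -m k + m l, by omega, ?_⟩
  have h₁ := hg k hk
  have h₂ := hg l hl
  rw [← hgkl] at h₂
  have h₃ : (w ^ k * u)⁻¹ * (w ^ l * u) = (w ^ m k)⁻¹ * w ^ m l := by
    rw [h₁, h₂]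
    group
  rw [zpow_add, zpow_neg, zpow_add, zpow_neg, ← h₃]
  group

end fixed

section ordered

variable {A : Type u} {B : Type v} [Group A] [Group B]
  [LinearOrder A] [MulRightMono A] [LinearOrder B] [MulRightMono B]

theorem exists_action_separating_prefixes {a : A} {b : B} {L M : List (A ⊕ B)}
    (hM : M = .inl a :: L ++ [.inr b]) (hcyc : IsCyclicallyReduced M)
    (hpow : ∀ (v : Coprod A B) (j : ℕ), 2 ≤ j → ofWord M ≠ v ^ j) :
    ∃ (X : Type (max u v)) (_ : LinearOrder X) (ρ : Coprod A B →* (X ≃o X)) (x : X),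
      ρ (ofWord M) x = x ∧ ∀ m₁ m₂, 1 ≤ m₁ → m₁ < m₂ → m₂ ≤ M.length →
        ρ (ofWord (M.take m₂) * (ofWord (M.take m₁))⁻¹) x ≠ x := by
  obtain ⟨_, _⟩ := exists_linearOrder_mulRightStrictMono A B
  have hw : ofWord M ≠ 1 := ofWord_ne_one hcyc.isReduced (by simp [hM])
  have hP : ∀ P, P <+: .inl a :: L → P ≠ [] → ∀ k : ℤ, ofWord P ≠ ofWord M ^ k := by
    intro P hP hne k hk
    have hPM : P <+: M := hP.trans (hM ▸ List.prefix_append _ _)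
    have hlen : P.length < M.length := by
      have := hP.length_le
      simp only [hM, List.length_append, List.length_singleton]
      omega
    refine conj_zpow_ofWord_ne hcyc hpow (List.length_pos_iff.2 hne) hlen.le (.inr hlen)
      (p := 1) (by simp) 1 ?_
    rw [← List.prefix_iff_eq_take.1 hPM, hk]
    simp only [List.take_zero, ofWord_nil]
    group
  subst hM
  obtain ⟨f, hf, hinf, hsupp⟩ := exists_affineHom_fixed a b L hw hP
  refine ⟨_, _, affineHom A B, toLex f, hf, fun m₁ m₂ h₁ h₁₂ h₂ hfix => ?_⟩
  set M := Sum.inl a :: L ++ [Sum.inr b]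
  have hT : ((fun P => (ofWord P)⁻¹) '' {P | P <+: M}).Finite :=
    ((List.finite_toSet M.inits).subset fun P hP => (List.mem_inits _ _).2 hP).image _
  obtain ⟨p, q, hp, hpq⟩ := exists_zpow_conj_of_affineHom_fixed hw hT hinf
    (fun y hy => (hsupp y hy).elim fun P hP => ⟨_, ⟨P, hP.1, rfl⟩, hP.2⟩) hfix
  have hq : q ≠ 0 := by
    rintro rfl
    rw [zpow_zero, mul_assoc, inv_mul_eq_iff_eq_mul, mul_one, mul_eq_right] at hpq
    exact hp (zpow_injective_of_ne_one hw (hpq.trans (zpow_zero _).symm))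
  refine conj_zpow_ofWord_ne hcyc hpow h₁₂ h₂ (.inl h₁) hq p ?_
  rw [← hpq]
  group

end ordered

theorem countable {A B : Type*} [Group A] [Group B] [Countable A] [Countable B] :
    Countable (Coprod A B) :=
  Function.Surjective.countable (f := ofWord (A := A) (B := B)) fun g =>
    (exists_isReduced g).imp fun _ h => h.2

end Monoid.Coprod

theorem IsRightOrderable.exists_mulRightMono {H : Type*} [Group H]
    (h : IsRightOrderable H) : ∃ _ : LinearOrder H, MulRightMono H := by
  classical
  obtain ⟨lt, hlt, hmul⟩ := h
  let : LinearOrder H := linearOrderOfSTO lt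
  have hmono : ∀ h : H, StrictMono (· * h) := fun h f g hfg => hmul f g h hfg
  exact ⟨inferInstance, ⟨fun h _ _ hfg => (hmono h).monotone hfg⟩⟩

namespace Monoid.Coprod

variable {A : Type u} {B : Type v}

/-- The word with letters `a₁, b₁, …, aₙ, bₙ`. -/
def alternatingWord (l : List (A × B)) : List (A ⊕ B) :=
  l.flatMap fun x => [.inl x.1, .inr x.2]

theorem isReduced_alternatingWord [Group A] [Group B] {l : List (A × B)}
    (h : ∀ x ∈ l, x.1 ≠ 1 ∧ x.2 ≠ 1) :
    IsReduced (alternatingWord l) := by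
  induction l with
  | nil => exact ⟨List.isChain_nil, by simp [alternatingWord]⟩
  | cons x l ih =>
    obtain ⟨hx, hl⟩ := List.forall_mem_cons.1 h
    refine IsReduced.cons (IsReduced.cons (ih hl) hx.2 ?_) hx.1 (by simp)
    cases l <;> simp

theorem isCyclicallyReduced_alternatingWord [Group A] [Group B] {l : List (A × B)}
    (h : ∀ x ∈ l, x.1 ≠ 1 ∧ x.2 ≠ 1) : IsCyclicallyReduced (alternatingWord l) := by
  intro k
  have hk : (List.replicate k (alternatingWord l)).flatten =
      alternatingWord (List.replicate k l).flatten := by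
    simp only [alternatingWord, List.flatMap_def, List.map_flatten, List.map_replicate,
      List.flatten_flatten]
  rw [hk]
  refine isReduced_alternatingWord fun x hx => ?_
  obtain ⟨m, hm, hx⟩ := List.mem_flatten.1 hx
  exact h x (List.eq_of_mem_replicate hm ▸ hx)

theorem exists_alternatingWord_eq {l : List (A × B)} (hl : l ≠ []) :
    ∃ a b L, alternatingWord l = .inl a :: L ++ [.inr b] := by
  obtain ⟨x, hx⟩ := List.exists_cons_of_ne_nil hl
  rcases List.eq_nil_or_concat l with rfl | ⟨l', y, rfl⟩
  · exact absurd rfl hl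
  rcases l' with - | ⟨x, l'⟩
  · exact ⟨y.1, y.2, [], rfl⟩
  · exact ⟨x.1, y.2, .inr x.2 :: alternatingWord l' ++ [.inl y.1], by simp [alternatingWord]⟩

theorem length_alternatingWord (l : List (A × B)) : (alternatingWord l).length = 2 * l.length := by
  simp [alternatingWord, List.length_flatMap, mul_comm]

theorem map_ofLetter_alternatingWord [Group A] [Group B] {n : ℕ} (a : Fin n → A)
    (b : Fin n → B) :
    (alternatingWord ((List.finRange n).map fun i => (a i, b i))).map ofLetter =
      wordLetters a b := by
  simp [alternatingWord, wordLetters, List.map_flatMap, List.flatMap_map, ofLetter]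

end Monoid.Coprod

open Monoid.Coprod in
/-- For a cyclically reduced non-proper-power word `w = a₁b₁⋯aₙbₙ` in a free product of
countable right-orderable groups and a prefix pair `(w₁, w₂)` of `w` (given by the
prefix `w₁` of length `m₁` and the prefix `w₁w₂` of length `m₂ > m₁`), there is a right
action `σ` of `A ∗ B` on `ℝ` and `x ∈ ℝ` with `x·σ(w) = x` and `x·σ(w₁w₂) ≠ x·σ(w₁)`. -/
theorem exists_action_separating_prefix_pair
    {A B : Type*} [Group A] [Group B] [Countable A] [Countable B]
    (hA : IsRightOrderable A) (hB : IsRightOrderable B)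
    {n : ℕ} (hn : 1 ≤ n) (a : Fin n → A) (b : Fin n → B)
    (ha : ∀ i, a i ≠ 1) (hb : ∀ i, b i ≠ 1)
    (hpow : ¬ ∃ (v : Monoid.Coprod A B) (j : ℤ), 2 ≤ j ∧ (wordLetters a b).prod = v ^ j)
    (m₁ m₂ : ℕ) (hm₁ : 1 ≤ m₁) (hm₁₂ : m₁ < m₂) (hm₂ : m₂ ≤ 2 * n) :
    ∃ (σ : Monoid.Coprod A B → (ℝ ≃o ℝ)) (x : ℝ),
      IsRightAction σ ∧
      σ ((wordLetters a b).prod) x = x ∧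
      σ (((wordLetters a b).take m₂).prod) x ≠ σ (((wordLetters a b).take m₁).prod) x := by
  obtain ⟨_, _⟩ := hA.exists_mulRightMono
  obtain ⟨_, _⟩ := hB.exists_mulRightMono
  set l := (List.finRange n).map fun i => (a i, b i) with hl
  have hl1 : ∀ x ∈ l, x.1 ≠ 1 ∧ x.2 ≠ 1 := by simp [hl, ha, hb]
  have hlen : l.length = n := by simp [hl]
  have hl0 : l ≠ [] := List.ne_nil_of_length_pos (hlen ▸ hn)
  obtain ⟨_, _, _, heq⟩ := exists_alternatingWord_eq hl0
  rw [← map_ofLetter_alternatingWord] at hpow ⊢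
  simp only [← List.map_take]
  obtain ⟨X, _, ρ, p, hfix, hsep⟩ := exists_action_separating_prefixes heq
    (isCyclicallyReduced_alternatingWord hl1)
    (fun v j hj hv => hpow ⟨v, j, by exact_mod_cast hj, by rw [zpow_natCast]; exact hv⟩)
  have := Monoid.Coprod.countable (A := A) (B := B)
  obtain ⟨σ, x, hσ⟩ := exists_real_action ρ p
  refine ⟨fun g => σ g⁻¹, x, fun g h => ?_, ?_, fun h => ?_⟩
  · change σ (g * h)⁻¹ = _
    rw [mul_inv_rev, map_mul]
    rfl
  · have hx : σ (ofWord (alternatingWord l)) x = x := (hσ _).2 hfix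
    change σ (ofWord (alternatingWord l))⁻¹ x = x
    conv_lhs => rw [← hx]
    rw [← RelIso.mul_apply, ← map_mul, inv_mul_cancel, map_one]
    rfl
  · refine hsep m₁ m₂ hm₁ hm₁₂ (by rwa [length_alternatingWord, hlen]) ((hσ _).1 ?_)
    rw [map_mul, RelIso.mul_apply]
    refine (congrArg _ h.symm).trans ?_
    change σ (ofWord _) (σ (ofWord _)⁻¹ x) = x
    rw [← RelIso.mul_apply, ← map_mul, mul_inv_cancel, map_one]
    rfl
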